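/- Let θ ≠ 0 and λ ∈ ℝ, and let H_λ := L²(ℝ, e^{2λa}da; ℂ) be the Hilbert space of square-integrable functions with respect to the measure with density e^{2λa} against Lebesgue measure. For (a,n) ∈ ℝ² define the operator U_{θ,λ}(a,n) on H_λ by (U_{θ,λ}(a,n)φ)(a₀) := e^{−λa + (i/θ)e^{2(a−a₀)}n}·φ(a₀ − a). Then each U_{θ,λ}(a,n) is a unitary operator on H_λ, and U_{θ,λ}((a,n)·(a',n')) = U_{θ,λ}(a,n) ∘ U_{θ,λ}(a',n') for the ax+b group law (a,n)·(a',n') = (a+a', e^{−2a'}n + n'); that is, U_{θ,λ} is a unitary representation of the ax+b group on H_λ. -/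

import Mathlib

open MeasureTheory

/-- For `θ ≠ 0` and `λ ∈ ℝ`, the operators
`(U_{θ,λ}(a,n)φ)(a₀) = e^{−λa + (i/θ)e^{2(a−a₀)}n} φ(a₀−a)` form a unitary
representation of the `ax+b` group on `H_λ = L²(ℝ, e^{2λa}da; ℂ)`: each
`U_{θ,λ}(a,n)` preserves the `L²(e^{2λa}da)`-norm, and
`U_{θ,λ}(x·x') = U_{θ,λ}(x) ∘ U_{θ,λ}(x')`. -/
theorem stmt_13 (θ lam : ℝ) (hθ : θ ≠ 0)
    (μ : Measure ℝ)
    (hμ : μ = volume.withDensity fun a => ENNReal.ofReal (Real.exp (2 * lam * a)))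
    (mul : ℝ × ℝ → ℝ × ℝ → ℝ × ℝ)
    (hmul : ∀ p q, mul p q = (p.1 + q.1, Real.exp (-(2 * q.1)) * p.2 + q.2))
    (U : ℝ × ℝ → (ℝ → ℂ) → (ℝ → ℂ))
    (hU : ∀ p φ a₀, U p φ a₀ =
      Complex.exp ((-(lam * p.1) : ℝ)
        + Complex.I / (θ : ℂ) * (Real.exp (2 * (p.1 - a₀)) : ℝ) * (p.2 : ℝ))
        * φ (a₀ - p.1)) :
    (∀ (p : ℝ × ℝ) (φ : ℝ → ℂ),
      ∫⁻ a, (‖U p φ a‖₊ : ENNReal) ^ 2 ∂μ = ∫⁻ a, (‖φ a‖₊ : ENNReal) ^ 2 ∂μ) ∧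
    (∀ (p q : ℝ × ℝ) (φ : ℝ → ℂ), U (mul p q) φ = U p (U q φ)) := by
  constructor
  · intro p φ
    have hm : Measurable fun a : ℝ => ENNReal.ofReal (Real.exp (2 * lam * a)) := by fun_prop
    have hfin : ∀ᵐ a : ℝ, ENNReal.ofReal (Real.exp (2 * lam * a)) < ⊤ :=
      Filter.Eventually.of_forall fun a => ENNReal.ofReal_lt_top
    have key : ∀ a, (‖U p φ a‖₊ : ENNReal)
        = ENNReal.ofReal (Real.exp (-(lam * p.1))) * (‖φ (a - p.1)‖₊ : ENNReal) := by
      intro a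
      have h1 : ‖Complex.exp ((-(lam * p.1) : ℝ)
          + Complex.I / (θ : ℂ) * (Real.exp (2 * (p.1 - a)) : ℝ) * (p.2 : ℝ))‖
          = Real.exp (-(lam * p.1)) := by
        rw [Complex.norm_exp]
        congr 1
        have h2 : ((-(lam * p.1) : ℝ) : ℂ)
          + Complex.I / (θ : ℂ) * (Real.exp (2 * (p.1 - a)) : ℝ) * (p.2 : ℝ)
          = ((-(lam * p.1) : ℝ) : ℂ)
            + ((θ⁻¹ * Real.exp (2 * (p.1 - a)) * p.2 : ℝ) : ℂ) * Complex.I := by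
          push_cast
          ring
        rw [h2, Complex.add_re, Complex.re_ofReal_mul, Complex.I_re, Complex.ofReal_re]
        ring
      rw [hU, nnnorm_mul, ENNReal.coe_mul]
      congr 1
      rw [← h1, ofReal_norm]
      rfl
    rw [hμ, lintegral_withDensity_eq_lintegral_mul_non_measurable _ hm hfin,
      lintegral_withDensity_eq_lintegral_mul_non_measurable _ hm hfin]
    refine Eq.trans (lintegral_congr fun a => ?_) (lintegral_sub_right_eq_self _ p.1)
    simp only [Pi.mul_apply, key]
    rw [mul_pow, ← mul_assoc, ← ENNReal.ofReal_pow (Real.exp_pos _).le,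
      ← ENNReal.ofReal_mul (Real.exp_pos _).le, ← Real.exp_nat_mul, ← Real.exp_add]
    congr 4
    push_cast
    ring
  · intro p q φ
    funext a
    rw [hU, hU, hU, hmul, ← mul_assoc, ← Complex.exp_add]
    simp only
    have e1 : a - (p.1 + q.1) = a - p.1 - q.1 := by ring
    have e2 : Real.exp (2 * (p.1 + q.1 - a)) * Real.exp (-(2 * q.1))
        = Real.exp (2 * (p.1 - a)) := by
      rw [← Real.exp_add]
      congr 1
      ring
    have e3 : q.1 - (a - p.1) = p.1 + q.1 - a := by ring
    rw [e1, e3, ← e2]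
    congr 2
    push_cast
    ring
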